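/- Let n ≥ 2 and work in Minkowski space ℝ^{1,n}. Let x be a future-oriented unit timelike vector and let r ∈ ℝ^{n+1} with ⟨r,r⟩ = 1. Then there exists a future-oriented unit timelike vector v with ⟨v,r⟩ = 0 and ⟨x,v⟩ = −√(1 + ⟨r,x⟩²). -/

import Mathlib

/-- The Minkowski bilinear form on ℝ^{1,n} = ℝ^{n+1}:
`⟨x,y⟩ = -x₀y₀ + ∑_{i=1}^n xᵢyᵢ`. -/
noncomputable def mink {n : ℕ} (x y : EuclideanSpace ℝ (Fin (n + 1))) : ℝ :=
  (∑ i, x i * y i) - 2 * x 0 * y 0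

theorem mink_eq_sum {n : ℕ} (x y : EuclideanSpace ℝ (Fin (n + 1))) :
    mink x y = (∑ i : Fin n, x i.succ * y i.succ) - x 0 * y 0 := by
  unfold mink
  rw [Fin.sum_univ_succ]
  ring

theorem mink_symm {n : ℕ} (x y : EuclideanSpace ℝ (Fin (n + 1))) : mink x y = mink y x := by
  simp only [mink_eq_sum, mul_comm]

theorem mink_comb {n : ℕ} (a b : ℝ) (x y z : EuclideanSpace ℝ (Fin (n + 1))) :
    mink (a • x + b • y) z = a * mink x z + b * mink y z := by
  simp only [mink_eq_sum, PiLp.add_apply, PiLp.smul_apply, smul_eq_mul, add_mul,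
    Finset.sum_add_distrib, mul_sub, Finset.mul_sum, mul_assoc]
  ring

theorem mink_pos {n : ℕ} (x w : EuclideanSpace ℝ (Fin (n + 1)))
    (hx : mink x x = -1) (hw : mink w w = -1) (h0 : 0 < x 0) (hxw : mink x w < 0) :
    0 < w 0 := by
  by_contra hneg
  have hneg := not_lt.mp hneg
  have cs := Finset.sum_mul_sq_le_sq_mul_sq Finset.univ
    (fun i : Fin n => x i.succ) (fun i : Fin n => w i.succ)
  rw [mink_eq_sum] at hx hw hxw
  simp only [← pow_two] at hx hw
  rw [show ∑ i : Fin n, x i.succ ^ 2 = x 0 ^ 2 - 1 by linarith,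
    show ∑ i : Fin n, w i.succ ^ 2 = w 0 ^ 2 - 1 by linarith] at cs
  have h1 : x 0 * w 0 ≤ 0 := mul_nonpos_of_nonneg_of_nonpos h0.le hneg
  set S := ∑ i : Fin n, x i.succ * w i.succ
  have h2 : (x 0 * w 0) ^ 2 ≤ S ^ 2 := by nlinarith
  have h3 : 1 ≤ x 0 ^ 2 := by
    have : 0 ≤ ∑ i : Fin n, x i.succ ^ 2 := Finset.sum_nonneg fun i _ => sq_nonneg _
    linarith
  have h4 : 1 ≤ w 0 ^ 2 := by
    have : 0 ≤ ∑ i : Fin n, w i.succ ^ 2 := Finset.sum_nonneg fun i _ => sq_nonneg _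
    linarith
  nlinarith

/-- Given a future-oriented unit timelike `x` and a unit spacelike `r`, there is a
future-oriented unit timelike `v` orthogonal to `r` with `⟨x,v⟩ = -√(1 + ⟨r,x⟩²)`. -/
theorem stmt7 (n : ℕ) (hn : 2 ≤ n) (x r : EuclideanSpace ℝ (Fin (n + 1)))
    (hx : mink x x = -1) (hxpos : 0 < x 0)
    (hr : mink r r = 1) :
    ∃ v : EuclideanSpace ℝ (Fin (n + 1)),
      mink v v = -1 ∧ 0 < v 0 ∧ mink v r = 0 ∧
      mink x v = -Real.sqrt (1 + (mink r x) ^ 2) := by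
  set c := mink r x with hc
  set s := Real.sqrt (1 + c ^ 2) with hs
  have hs0 : 0 < s := Real.sqrt_pos.mpr (by positivity)
  have hs2 : s ^ 2 = 1 + c ^ 2 := Real.sq_sqrt (by positivity)
  have hxr : mink x r = c := mink_symm x r
  have e1 : mink (s⁻¹ • x + (-(s⁻¹ * c)) • r) r = 0 := by
    rw [mink_comb, hxr, hr]; ring
  have e2 : mink (s⁻¹ • x + (-(s⁻¹ * c)) • r) x = -s := by
    rw [mink_comb, hx, ← hc]
    field_simp
    linarith
  have e3 : mink (s⁻¹ • x + (-(s⁻¹ * c)) • r) (s⁻¹ • x + (-(s⁻¹ * c)) • r) = -1 := by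
    rw [mink_comb, mink_symm x, mink_symm r, e1, e2]
    field_simp
    ring
  have e4 : mink x (s⁻¹ • x + (-(s⁻¹ * c)) • r) = -s := by rw [mink_symm, e2]
  exact ⟨_, e3, mink_pos x _ hx e3 hxpos (by rw [e4]; linarith), e1, e4⟩
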